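/- Let u and w be distinct points of ℝ² whose first coordinates differ by at least ω₁. Then the one-point-conditioned posterior variance σ²_{u|w} := σ(u,u) − σ(u,w)²/σ(w,w) satisfies σ²_{u|w} ≥ σ_s² + σ_n² − σ_s²·ξ² = σ_s²·(ρ − ξ²) > 0. -/

import Mathlib

open Real

/-- Squared exponential covariance function on ℝ². -/
noncomputable def seCov (σs σn ℓ₁ ℓ₂ : ℝ) (u v : ℝ × ℝ) : ℝ :=
  σs ^ 2 * Real.exp (-((u.1 - v.1) ^ 2) / (2 * ℓ₁ ^ 2) - (u.2 - v.2) ^ 2 / (2 * ℓ₂ ^ 2)) +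
    σn ^ 2 * (if u = v then 1 else 0)

theorem seCov_self (σs σn ℓ₁ ℓ₂ : ℝ) (u : ℝ × ℝ) :
    seCov σs σn ℓ₁ ℓ₂ u u = σs ^ 2 + σn ^ 2 := by
  simp [seCov]

theorem seCov_nonneg (σs σn ℓ₁ ℓ₂ : ℝ) (u v : ℝ × ℝ) : 0 ≤ seCov σs σn ℓ₁ ℓ₂ u v := by
  unfold seCov
  split_ifs <;> positivity

/-- Points with horizontal separation at least `ω` have covariance at most that of two noiseless
points at horizontal distance exactly `ω`. -/
theorem seCov_le_of_le_abs_sub {σs σn ℓ₁ ℓ₂ ω : ℝ} {u v : ℝ × ℝ} (hω : 0 ≤ ω) (huv : u ≠ v)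
    (hsep : ω ≤ |u.1 - v.1|) :
    seCov σs σn ℓ₁ ℓ₂ u v ≤ σs ^ 2 * Real.exp (-ω ^ 2 / (2 * ℓ₁ ^ 2)) := by
  have hsq : ω ^ 2 ≤ (u.1 - v.1) ^ 2 := by
    rw [← sq_abs (u.1 - v.1)]
    gcongr
  have hhor : -((u.1 - v.1) ^ 2) / (2 * ℓ₁ ^ 2) ≤ -ω ^ 2 / (2 * ℓ₁ ^ 2) := by
    gcongr
  have hver : 0 ≤ (u.2 - v.2) ^ 2 / (2 * ℓ₂ ^ 2) := by positivity
  simp only [seCov, huv, if_false, mul_zero, add_zero]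
  gcongr
  linarith

theorem stmt_4 (σs σn ℓ₁ ℓ₂ ω₁ ξ ρ : ℝ)
    (hσs : 0 < σs) (hσn : 0 < σn) (hℓ₁ : 0 < ℓ₁) (hℓ₂ : 0 < ℓ₂) (hω₁ : 0 < ω₁)
    (hξ : ξ = Real.exp (-ω₁ ^ 2 / (2 * ℓ₁ ^ 2)))
    (hρ : ρ = 1 + σn ^ 2 / σs ^ 2)
    (u w : ℝ × ℝ) (huw : u ≠ w) (hsep : ω₁ ≤ |u.1 - w.1|) :
    σs ^ 2 + σn ^ 2 - σs ^ 2 * ξ ^ 2 ≤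
        seCov σs σn ℓ₁ ℓ₂ u u - (seCov σs σn ℓ₁ ℓ₂ u w) ^ 2 / seCov σs σn ℓ₁ ℓ₂ w w ∧
      σs ^ 2 + σn ^ 2 - σs ^ 2 * ξ ^ 2 = σs ^ 2 * (ρ - ξ ^ 2) ∧
      0 < σs ^ 2 * (ρ - ξ ^ 2) := by
  have hσs2 : 0 < σs ^ 2 := by positivity
  have hσn2 : 0 < σn ^ 2 := by positivity
  have hcov : seCov σs σn ℓ₁ ℓ₂ u w ≤ σs ^ 2 * ξ :=
    hξ ▸ seCov_le_of_le_abs_sub hω₁.le huw hsep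
  have heq : σs ^ 2 + σn ^ 2 - σs ^ 2 * ξ ^ 2 = σs ^ 2 * (ρ - ξ ^ 2) := by
    rw [hρ]
    field_simp
  have hξ0 : 0 ≤ ξ := hξ ▸ (Real.exp_pos _).le
  have hξ1 : ξ ≤ 1 := by
    rw [hξ, Real.exp_le_one_iff, neg_div]
    exact neg_nonpos.mpr (by positivity)
  have hξsq : ξ ^ 2 ≤ 1 := pow_le_one₀ hξ0 hξ1
  refine ⟨?_, heq, ?_⟩
  · rw [seCov_self, seCov_self]
    have hdiv : seCov σs σn ℓ₁ ℓ₂ u w ^ 2 / (σs ^ 2 + σn ^ 2) ≤ σs ^ 2 * ξ ^ 2 := by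
      rw [div_le_iff₀ (by positivity)]
      calc seCov σs σn ℓ₁ ℓ₂ u w ^ 2 ≤ (σs ^ 2 * ξ) ^ 2 :=
            pow_le_pow_left₀ (seCov_nonneg ..) hcov 2
        _ = σs ^ 2 * ξ ^ 2 * σs ^ 2 := by ring
        _ ≤ σs ^ 2 * ξ ^ 2 * (σs ^ 2 + σn ^ 2) := by
            gcongr
            linarith
    linarith
  · rw [← heq]
    nlinarith
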